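/- arXiv:0911.3940 — 2 statements merged into one kernel-verified Lean document; each statement's English description precedes it below -/
import Mathlib

section
/- Let A : ℝ → ℝ and η : ℝ → ℝ be smooth with A″ > 0 and η″ > 0 everywhere. Let R > 0 and let ε_η, L_η, L_A > 0 satisfy ε_η ≤ η″(ξ) ≤ L_η and A″(ξ) ≤ L_A for all |ξ| ≤ R. Then for all U, C ∈ [−R,R] with U ≠ C, the partial derivative of f with respect to its first variable satisfies 0 ≤ ∂f/∂U(U,C) ≤ L_η L_A / ε_η. -/
open MeasureTheory Set Filter Topology

noncomputable section

/-- The Riemann data `φ` with left state `CL` and right state `CR`. -/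
def riemann (CL CR : ℝ) (x : ℝ) : ℝ := if x < 0 then CL else CR

/-- The relative entropy `η(v | C) = η(v) - η(C) - η'(C)(v - C)`. -/
def relEnt (η : ℝ → ℝ) (v C : ℝ) : ℝ := η v - η C - deriv η C * (v - C)

/-- The relative entropy flux `F(v, C) = ∫_C^v (η'(w) - η'(C)) A'(w) dw`. -/
def relFlux (A η : ℝ → ℝ) (v C : ℝ) : ℝ := ∫ w in C..v, (deriv η w - deriv η C) * deriv A w

/-- The normalized relative entropy flux `f(v, C) = F(v, C) / η(v | C)` for `v ≠ C`,
extended by `f(C, C) = A'(C)` on the diagonal. -/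
def normFlux (A η : ℝ → ℝ) (v C : ℝ) : ℝ :=
  if v = C then deriv A C else relFlux A η v C / relEnt η v C

/-- `U` is a bounded measurable entropy solution of `∂ₜ U + ∂ₓ A(U) = 0` on `ℝ × (0, ∞)`:
for every entropy/entropy-flux pair `(η, G)` with `η'' ≥ 0` and `G' = η' A'`, and every
nonnegative smooth compactly supported test function `θ` vanishing for `t ≤ 0`, one has
`∫₀^∞ ∫_ℝ (η(U) ∂ₜθ + G(U) ∂ₓθ) dx dt ≥ 0`. -/
structure IsEntropySol (A : ℝ → ℝ) (U : ℝ → ℝ → ℝ) : Prop where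
  bounded : ∃ M, ∀ x t, |U x t| ≤ M
  measurable : Measurable fun p : ℝ × ℝ => U p.1 p.2
  entropy : ∀ η G : ℝ → ℝ, ContDiff ℝ (⊤ : ℕ∞) η → ContDiff ℝ (⊤ : ℕ∞) G →
    (∀ v, 0 ≤ deriv (deriv η) v) → (∀ v, deriv G v = deriv η v * deriv A v) →
    ∀ θ : ℝ → ℝ → ℝ, ContDiff ℝ (⊤ : ℕ∞) (fun p : ℝ × ℝ => θ p.1 p.2) →
      HasCompactSupport (fun p : ℝ × ℝ => θ p.1 p.2) →
      (∀ x t, 0 ≤ θ x t) → (∀ x t, t ≤ 0 → θ x t = 0) →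
      0 ≤ ∫ t in Ioi (0 : ℝ), ∫ x : ℝ,
        (η (U x t) * deriv (fun s => θ x s) t + G (U x t) * deriv (fun y => θ y t) x)

/-- `Um x t = U(x-, t)` and `Up x t = U(x+, t)` are the one-sided spatial limits of `U`,
satisfying `U(x-, t) ≥ U(x+, t)` for all `x` and all `t > 0`. -/
structure HasSideLimits (U Um Up : ℝ → ℝ → ℝ) : Prop where
  left : ∀ x t : ℝ, 0 < t → Tendsto (fun y => U y t) (𝓝[<] x) (𝓝 (Um x t))
  right : ∀ x t : ℝ, 0 < t → Tendsto (fun y => U y t) (𝓝[>] x) (𝓝 (Up x t))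
  mono : ∀ x t : ℝ, 0 < t → Up x t ≤ Um x t

/-- `t ↦ U(·, t)` is continuous from `[0, ∞)` into `L¹_loc(ℝ)`. -/
def L1locCont (U : ℝ → ℝ → ℝ) : Prop :=
  ∀ R > (0 : ℝ), ∀ t₀ ≥ (0 : ℝ),
    Tendsto (fun t => ∫ x in (-R)..R, |U x t - U x t₀|) (𝓝[≥] t₀) (𝓝 0)

/-- `x` is a Filippov solution on the set `s` of the differential inclusion
`ẋ(t) ∈ [f(U(x(t)+, t), C), f(U(x(t)-, t), C)]`, where `f` is the normalized relative
entropy flux: `x` is Lipschitz on `s` and for a.e. `t ∈ s` it has a derivative lying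
in the prescribed interval. -/
def IsFilippov (A η : ℝ → ℝ) (Um Up : ℝ → ℝ → ℝ) (C : ℝ) (s : Set ℝ) (x : ℝ → ℝ) : Prop :=
  (∃ K : NNReal, LipschitzOnWith K x s) ∧
  ∀ᵐ t ∂(volume.restrict s), ∃ d, HasDerivAt x d t ∧
    normFlux A η (Up (x t) t) C ≤ d ∧ d ≤ normFlux A η (Um (x t) t) C

/-- The mean value theorem on the segment from `C` to `U`, whatever the order of `C` and `U`. -/
lemma exists_deriv_mul_sub_of_eq_zero {h h' : ℝ → ℝ} {C : ℝ}
    (hh : ∀ x, HasDerivAt h (h' x) x) (h0 : h C = 0) (U : ℝ) :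
    ∃ t, 0 < t ∧ t < 1 ∧ h U = h' (C + t * (U - C)) * (U - C) := by
  have hd : ∀ t : ℝ, HasDerivAt (fun t => h (C + t * (U - C)))
      (h' (C + t * (U - C)) * (U - C)) t := fun t => by
    have hl : HasDerivAt (fun t : ℝ => C + t * (U - C)) (U - C) t := by
      simpa using ((hasDerivAt_id t).mul_const (U - C)).const_add C
    exact (hh _).comp t hl
  obtain ⟨t, ht, he⟩ := exists_hasDerivAt_eq_slope (fun t => h (C + t * (U - C))) _ zero_lt_one
    (fun t _ => (hd t).continuousAt.continuousWithinAt) (fun t _ => hd t)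
  refine ⟨t, ht.1, ht.2, ?_⟩
  rw [he]
  simp [h0]

/-- A function vanishing at `C` whose derivative is nonnegative on `[-R, R]` has the sign
of `v - C` there. -/
lemma mul_sub_nonneg_of_deriv_nonneg {h h' : ℝ → ℝ} {C R : ℝ} (hC : |C| ≤ R)
    (hh : ∀ x, HasDerivAt h (h' x) x) (h0 : h C = 0) (hp : ∀ x, |x| ≤ R → 0 ≤ h' x)
    {v : ℝ} (hv : |v| ≤ R) : 0 ≤ h v * (v - C) := by
  obtain ⟨t, ht0, ht1, he⟩ := exists_deriv_mul_sub_of_eq_zero hh h0 v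
  rw [abs_le] at hC hv
  have hx : |C + t * (v - C)| ≤ R := by
    rw [abs_le]; constructor <;> nlinarith
  rw [he, mul_assoc]
  exact mul_nonneg (hp _ hx) (mul_self_nonneg _)

/-- A function vanishing at `C` whose derivative has the sign of `x - C` on `[-R, R]` is
nonnegative there. -/
lemma nonneg_of_deriv_mul_sub_nonneg {h h' : ℝ → ℝ} {C R : ℝ} (hC : |C| ≤ R)
    (hh : ∀ x, HasDerivAt h (h' x) x) (h0 : h C = 0) (hp : ∀ x, |x| ≤ R → 0 ≤ h' x * (x - C))
    {v : ℝ} (hv : |v| ≤ R) : 0 ≤ h v := by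
  obtain ⟨t, ht0, ht1, he⟩ := exists_deriv_mul_sub_of_eq_zero hh h0 v
  rw [abs_le] at hC hv
  have hx : |C + t * (v - C)| ≤ R := by
    rw [abs_le]; constructor <;> nlinarith
  have := hp _ hx
  rw [he]
  refine nonneg_of_mul_nonneg_left (b := t) ?_ ht0
  linarith

lemma hasDerivAt_relEnt {η : ℝ → ℝ} (hη : Differentiable ℝ η) (v C : ℝ) :
    HasDerivAt (fun v => relEnt η v C) (deriv η v - deriv η C) v := by
  have h := ((hη v).hasDerivAt.sub_const (η C)).sub
    (((hasDerivAt_id v).sub_const C).const_mul (deriv η C))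
  rw [mul_one] at h
  exact h

lemma hasDerivAt_relFlux {A η : ℝ → ℝ} (hA : Continuous (deriv A)) (hη : Continuous (deriv η))
    (v C : ℝ) :
    HasDerivAt (fun v => relFlux A η v C) ((deriv η v - deriv η C) * deriv A v) v :=
  (show Continuous fun w => (deriv η w - deriv η C) * deriv A w by
    fun_prop).integral_hasStrictDerivAt C v |>.hasDerivAt

lemma hasDerivAt_normFlux {A η : ℝ → ℝ} (hA : Continuous (deriv A)) (hη : Differentiable ℝ η)
    (hη' : Continuous (deriv η)) {v C : ℝ} (hvC : v ≠ C) (hE : relEnt η v C ≠ 0) :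
    HasDerivAt (fun v => normFlux A η v C)
      ((deriv η v - deriv η C) * (deriv A v * relEnt η v C - relFlux A η v C)
        / relEnt η v C ^ 2) v := by
  have hq := (hasDerivAt_relFlux hA hη' v C).div (hasDerivAt_relEnt hη v C) hE
  have hq' : HasDerivAt (fun v => relFlux A η v C / relEnt η v C)
      ((deriv η v - deriv η C) * (deriv A v * relEnt η v C - relFlux A η v C)
        / relEnt η v C ^ 2) v := by
    refine hq.congr_deriv ?_
    ring
  refine hq'.congr_of_eventuallyEq ?_
  filter_upwards [isOpen_ne.mem_nhds hvC] with x hx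
  exact if_neg hx

/-- **Lemma 2.6 (i).** On a bounded set, the partial derivative of the normalized relative
entropy flux `f` with respect to its first variable exists and satisfies
`0 ≤ ∂f/∂U ≤ L_η L_A / ε_η`. -/
theorem normFlux_deriv_fst_bounds
    (A η : ℝ → ℝ) (hA : ContDiff ℝ (⊤ : ℕ∞) A) (hη : ContDiff ℝ (⊤ : ℕ∞) η)
    (hA'' : ∀ x, 0 < deriv (deriv A) x) (hη'' : ∀ x, 0 < deriv (deriv η) x)
    (R εη Lη LA : ℝ) (hR : 0 < R) (hεη : 0 < εη) (hLη : 0 < Lη) (hLA : 0 < LA)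
    (hηbd : ∀ ξ : ℝ, |ξ| ≤ R → εη ≤ deriv (deriv η) ξ ∧ deriv (deriv η) ξ ≤ Lη)
    (hAbd : ∀ ξ : ℝ, |ξ| ≤ R → deriv (deriv A) ξ ≤ LA)
    (U C : ℝ) (hU : |U| ≤ R) (hC : |C| ≤ R) (hUC : U ≠ C) :
    ∃ d, HasDerivAt (fun v => normFlux A η v C) d U ∧ 0 ≤ d ∧ d ≤ Lη * LA / εη := by
  have hA1 : ContDiff ℝ (⊤ : ℕ∞) (deriv A) := (contDiff_infty_iff_deriv.1 hA).2
  have hη1 : ContDiff ℝ (⊤ : ℕ∞) (deriv η) := (contDiff_infty_iff_deriv.1 hη).2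
  have hdA : ∀ x, HasDerivAt (deriv A) (deriv (deriv A) x) x := fun x =>
    (hA1.differentiable (by simp) x).hasDerivAt
  have hdη : ∀ x, HasDerivAt (fun x => deriv η x - deriv η C) (deriv (deriv η) x) x := fun x =>
    (hη1.differentiable (by simp) x).hasDerivAt.sub_const _
  have hη0 : Differentiable ℝ η := hη.differentiable (by simp)
  have hdE : ∀ x, HasDerivAt (fun x => relEnt η x C) (deriv η x - deriv η C) x := fun x =>
    hasDerivAt_relEnt hη0 x C
  have hdF : ∀ x, HasDerivAt (fun x => relFlux A η x C)
      ((deriv η x - deriv η C) * deriv A x) x := fun x =>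
    hasDerivAt_relFlux hA1.continuous hη1.continuous x C
  have hds : ∀ x, HasDerivAt (fun x => x - C) 1 x := fun x => (hasDerivAt_id x).sub_const C
  have hE0 : relEnt η C C = 0 := by simp [relEnt]
  have hF0 : relFlux A η C C = 0 := by simp [relFlux]
  have hg_lower : ∀ x, |x| ≤ R →
      0 ≤ ((deriv η x - deriv η C) - εη * (x - C)) * (x - C) := fun x hx =>
    mul_sub_nonneg_of_deriv_nonneg (h := fun x => (deriv η x - deriv η C) - εη * (x - C)) hC
      (fun x => (hdη x).sub ((hds x).const_mul εη)) (by simp)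
      (fun x hx => by linarith [(hηbd x hx).1]) hx
  have hg_upper : 0 ≤ (Lη * (U - C) - (deriv η U - deriv η C)) * (U - C) :=
    mul_sub_nonneg_of_deriv_nonneg (h := fun x => Lη * (x - C) - (deriv η x - deriv η C)) hC
      (fun x => ((hds x).const_mul Lη).sub (hdη x)) (by simp)
      (fun x hx => by linarith [(hηbd x hx).2]) hU
  have hE_lower : ∀ x, |x| ≤ R → 0 ≤ relEnt η x C - εη / 2 * (x - C) ^ 2 := fun x hx =>
    nonneg_of_deriv_mul_sub_nonneg (h := fun x => relEnt η x C - εη / 2 * (x - C) ^ 2) hC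
      (fun x => (hdE x).sub (((hds x).pow 2).const_mul (εη / 2))) (by simp [hE0])
      (fun x hx => by
        have := hg_lower x hx
        simp only [Nat.cast_ofNat, Nat.add_one_sub_one, pow_one]
        linarith) hx
  have hE_nonneg : ∀ x, |x| ≤ R → 0 ≤ relEnt η x C := fun x hx => by
    have := hE_lower x hx
    have : 0 ≤ εη / 2 * (x - C) ^ 2 := by positivity
    linarith
  have hE_upper : ∀ x, |x| ≤ R →
      0 ≤ (deriv η x - deriv η C) * (x - C) - relEnt η x C := fun x hx =>
    nonneg_of_deriv_mul_sub_nonneg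
      (h := fun x => (deriv η x - deriv η C) * (x - C) - relEnt η x C) hC
      (fun x => ((hdη x).mul (hds x)).sub (hdE x)) (by simp [hE0])
      (fun x _ => by
        have := mul_nonneg (hη'' x).le (mul_self_nonneg (x - C))
        linarith) hx
  have hdP : ∀ x, HasDerivAt (fun x => deriv A x * relEnt η x C - relFlux A η x C)
      (deriv (deriv A) x * relEnt η x C) x := fun x => by
    refine (((hdA x).mul (hdE x)).sub (hdF x)).congr_deriv ?_
    ring
  have hP_lower : 0 ≤ (deriv A U * relEnt η U C - relFlux A η U C) * (U - C) :=
    mul_sub_nonneg_of_deriv_nonneg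
      (h := fun x => deriv A x * relEnt η x C - relFlux A η x C) hC hdP (by simp [hE0, hF0])
      (fun x hx => mul_nonneg (hA'' x).le (hE_nonneg x hx)) hU
  -- Chebyshev's integral inequality in differential form; this is what makes the constant sharp.
  have hP_upper : 0 ≤ (LA / 2 * (relEnt η U C * (U - C))
      - (deriv A U * relEnt η U C - relFlux A η U C)) * (U - C) :=
    mul_sub_nonneg_of_deriv_nonneg
      (h := fun x => LA / 2 * (relEnt η x C * (x - C))
        - (deriv A x * relEnt η x C - relFlux A η x C)) hC
      (fun x => (((hdE x).mul (hds x)).const_mul (LA / 2)).sub (hdP x)) (by simp [hE0, hF0])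
      (fun x hx => by
        have h1 := mul_nonneg hLA.le (hE_upper x hx)
        have h2 := mul_nonneg (sub_nonneg.2 (hAbd x hx)) (hE_nonneg x hx)
        linarith) hU
  have hs : 0 < (U - C) ^ 2 := by
    have := sub_ne_zero.2 hUC
    positivity
  have hEU := hE_lower U hU
  have hE_pos : 0 < relEnt η U C := by
    have : 0 < εη / 2 * (U - C) ^ 2 := by positivity
    linarith
  refine ⟨_, hasDerivAt_normFlux hA1.continuous hη0 hη1.continuous hUC hE_pos.ne', ?_⟩
  have hgU : 0 ≤ (deriv η U - deriv η C) * (U - C) := by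
    linarith [hE_upper U hU]
  generalize deriv A U * relEnt η U C - relFlux A η U C = P at *
  generalize deriv η U - deriv η C = g at *
  generalize relEnt η U C = E at *
  constructor
  · refine div_nonneg (nonneg_of_mul_nonneg_left ?_ hs) (sq_nonneg E)
    linarith [mul_nonneg hgU hP_lower]
  · rw [div_le_div_iff₀ (by positivity) hεη]
    have h1 : (g * (U - C)) * (P * (U - C))
        ≤ (Lη * (U - C) ^ 2) * (LA / 2 * E * (U - C) ^ 2) :=
      mul_le_mul (by linarith) (by linarith) hP_lower (by positivity)
    have h2 : g * P ≤ Lη * LA * E * ((U - C) ^ 2 / 2) := by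
      refine le_of_mul_le_mul_right ?_ hs
      linarith
    have h3 : 0 ≤ Lη * LA * E * (E - εη / 2 * (U - C) ^ 2) := by positivity
    have h4 := mul_le_mul_of_nonneg_right h2 hεη.le
    linarith
end
end

section
/- Let A : ℝ → ℝ and η : ℝ → ℝ be smooth with A″ > 0 and η″ > 0 everywhere. For all U, C ∈ ℝ with U ≠ C, the function f is differentiable in its second variable at (U,C) and ∂f/∂C(U,C) = [−η″(C)(U − C) / η(U|C)] · [(A(U) − A(C))/(U − C) − f(U,C)]. -/
open MeasureTheory Set Filter Topology

noncomputable section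

lemma relEnt_hasDerivAt_snd {η : ℝ → ℝ} (hη : ContDiff ℝ 2 η) (U C : ℝ) :
    HasDerivAt (fun c => relEnt η U c) (-(deriv (deriv η) C) * (U - C)) C := by
  have h1 : HasDerivAt η (deriv η C) C :=
    (hη.differentiable (by norm_num) C).hasDerivAt
  have h2 : HasDerivAt (deriv η) (deriv (deriv η) C) C :=
    (hη.differentiable_deriv_two C).hasDerivAt
  have h := (h1.const_sub (η U)).sub (h2.mul ((hasDerivAt_id C).const_sub U))
  refine h.congr_deriv ?_
  simp only [id]
  ring

lemma relEnt_ne_zero {η : ℝ → ℝ} (hη : ContDiff ℝ 2 η)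
    (hη'' : ∀ x, 0 < deriv (deriv η) x) {U C : ℝ} (hUC : U ≠ C) : relEnt η U C ≠ 0 := by
  intro h0
  have hd := relEnt_hasDerivAt_snd hη U
  have hc : Continuous (fun c => relEnt η U c) :=
    continuous_iff_continuousAt.2 fun c => (hd c).continuousAt
  have hU : relEnt η U U = 0 := by simp [relEnt]
  rcases lt_or_gt_of_ne hUC with h | h
  · obtain ⟨ξ, hξ, e⟩ := exists_hasDerivAt_eq_zero h hc.continuousOn (hU.trans h0.symm)
      fun c _ => hd c
    exact mul_ne_zero (neg_ne_zero.2 (hη'' ξ).ne') (sub_ne_zero.2 hξ.1.ne) e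
  · obtain ⟨ξ, hξ, e⟩ := exists_hasDerivAt_eq_zero h hc.continuousOn (h0.trans hU.symm)
      fun c _ => hd c
    exact mul_ne_zero (neg_ne_zero.2 (hη'' ξ).ne') (sub_ne_zero.2 hξ.2.ne') e

lemma relFlux_eq {A η : ℝ → ℝ} (hA : ContDiff ℝ 1 A) (hη : ContDiff ℝ 1 η) (v C : ℝ) :
    relFlux A η v C = (∫ w in C..v, deriv η w * deriv A w) - deriv η C * (A v - A C) := by
  have hA' : Continuous (deriv A) := hA.continuous_deriv le_rfl
  have hη' : Continuous (deriv η) := hη.continuous_deriv le_rfl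
  have hI : ∫ w in C..v, deriv A w = A v - A C :=
    intervalIntegral.integral_deriv_eq_sub
      (fun x _ => hA.differentiable one_ne_zero x) (hA'.intervalIntegrable _ _)
  simp only [relFlux, sub_mul]
  rw [intervalIntegral.integral_sub (Continuous.intervalIntegrable (by fun_prop) _ _)
    (Continuous.intervalIntegrable (by fun_prop) _ _),
    intervalIntegral.integral_const_mul, hI]

lemma relFlux_hasDerivAt_snd {A η : ℝ → ℝ} (hA : ContDiff ℝ 1 A) (hη : ContDiff ℝ 2 η)
    (U C : ℝ) :
    HasDerivAt (fun c => relFlux A η U c) (-(deriv (deriv η) C) * (A U - A C)) C := by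
  have hη1 : ContDiff ℝ 1 η := hη.of_le (by norm_num)
  have hc : Continuous fun w => deriv η w * deriv A w :=
    (hη1.continuous_deriv le_rfl).mul (hA.continuous_deriv le_rfl)
  have hI : HasDerivAt (fun c => ∫ w in c..U, deriv η w * deriv A w)
      (-(deriv η C * deriv A C)) C :=
    intervalIntegral.integral_hasDerivAt_left (hc.intervalIntegrable _ _)
      hc.stronglyMeasurable.stronglyMeasurableAtFilter hc.continuousAt
  have h1 : HasDerivAt A (deriv A C) C := (hA.differentiable one_ne_zero C).hasDerivAt
  have h2 : HasDerivAt (deriv η) (deriv (deriv η) C) C :=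
    (hη.differentiable_deriv_two C).hasDerivAt
  have h := hI.sub (h2.mul (h1.const_sub (A U)))
  rw [funext (relFlux_eq hA hη1 U)]
  refine h.congr_deriv ?_
  ring

/-- **Formula (2.9).** Off the diagonal, the normalized relative entropy flux `f` is
differentiable in its second variable with
`∂f/∂C (U, C) = [-η''(C)(U - C) / η(U|C)] ⬝ [(A(U) - A(C))/(U - C) - f(U, C)]`. -/
theorem normFlux_hasDerivAt_snd
    (A η : ℝ → ℝ) (hA : ContDiff ℝ (⊤ : ℕ∞) A) (hη : ContDiff ℝ (⊤ : ℕ∞) η)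
    (hA'' : ∀ x, 0 < deriv (deriv A) x) (hη'' : ∀ x, 0 < deriv (deriv η) x)
    (U C : ℝ) (hUC : U ≠ C) :
    HasDerivAt (fun c => normFlux A η U c)
      (-(deriv (deriv η) C) * (U - C) / relEnt η U C
        * ((A U - A C) / (U - C) - normFlux A η U C)) C := by
  have hA1 : ContDiff ℝ 1 A := contDiff_infty.1 hA 1
  have hη2 : ContDiff ℝ 2 η := contDiff_infty.1 hη 2
  have hE := relEnt_ne_zero hη2 hη'' hUC
  have hsub : U - C ≠ 0 := sub_ne_zero.2 hUC
  have h := (relFlux_hasDerivAt_snd hA1 hη2 U C).div (relEnt_hasDerivAt_snd hη2 U C) hE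
  have hev : (fun c => normFlux A η U c) =ᶠ[𝓝 C] fun c => relFlux A η U c / relEnt η U c := by
    filter_upwards [isOpen_ne.mem_nhds hUC.symm] with c hc
    exact if_neg (Ne.symm hc)
  refine (h.congr_of_eventuallyEq hev).congr_deriv ?_
  rw [normFlux, if_neg hUC]
  field_simp
  ring
end
end
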